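/- For every connected finite graph G the following are equivalent: (1) G admits a bipolar numbering; (2) for every pair of monotonic valuations for two agents over the connected bundles of G there exists a connected EF1 allocation; (3) for every identical, additive, binary valuations for two agents there exists a connected EF1 allocation. -/

import Mathlib

variable {V : Type*}

/-- A bundle `I` is connected in `G` if the induced subgraph on `I` is preconnected
(this holds vacuously for the empty bundle). -/
def GConnBundle (G : SimpleGraph V) (I : Finset V) : Prop :=
  (G.induce (↑I : Set V)).Preconnected

/-- A valuation over bundles is monotonic if larger bundles are weakly better. -/
def GMonotonic (u : Finset V → ℝ) : Prop :=
  ∀ X Y : Finset V, X ⊆ Y → u X ≤ u Y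

/-- A connected allocation: every bundle is connected in `G`, bundles are pairwise disjoint,
and every item belongs to some bundle. -/
def GConnAlloc {n : ℕ} (G : SimpleGraph V) (A : Fin n → Finset V) : Prop :=
  (∀ i, GConnBundle G (A i)) ∧ (∀ i j, i ≠ j → Disjoint (A i) (A j)) ∧
    ∀ v : V, ∃ i, v ∈ A i

/-- EF1 (envy-freeness up to one outer good) for connected bundles of a graph. -/
def GEF1 {n : ℕ} [DecidableEq V] (G : SimpleGraph V) (u : Fin n → Finset V → ℝ)
    (A : Fin n → Finset V) : Prop :=
  ∀ i j : Fin n, A j = ∅ ∨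
    ∃ v ∈ A j, GConnBundle G (A j \ {v}) ∧ u i (A j \ {v}) ≤ u i (A i)

/-- A bipolar numbering of `G`: an ordering `e` of the vertices such that every initial
segment `{v_1,…,v_j}` and every terminal segment `{v_j,…,v_m}` is connected. -/
def BipolarNumbering [Fintype V] [DecidableEq V] (G : SimpleGraph V)
    (e : Fin (Fintype.card V) ≃ V) : Prop :=
  ∀ j : Fin (Fintype.card V),
    GConnBundle G ((Finset.Iic j).image e) ∧ GConnBundle G ((Finset.Ici j).image e)

section GraphBranches

variable {G : SimpleGraph V}

theorem gConnBundle_iff {I : Finset V} :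
    GConnBundle G I ↔ ∀ T ⊆ I, T.Nonempty →
      (∀ x ∈ T, ∀ y ∈ I, G.Adj x y → y ∈ T) → I ⊆ T := by
  classical
  constructor
  · rintro h T hT ⟨x, hx⟩ hcl y hy
    have hr := h ⟨x, hT hx⟩ ⟨y, hy⟩
    rw [SimpleGraph.reachable_iff_reflTransGen] at hr
    have key : ∀ z : (↑I : Set V),
        Relation.ReflTransGen (G.induce (↑I : Set V)).Adj ⟨x, hT hx⟩ z → z.1 ∈ T := by
      intro z hz
      induction hz with
      | refl => exact hx
      | tail _ hadj ih => exact hcl _ ih _ (by simp) hadj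
    exact key _ hr
  · rintro h ⟨x, hx⟩ ⟨y, hy⟩
    have hsub := h (I.filter fun z => ∃ hz : z ∈ (↑I : Set V),
        (G.induce (↑I : Set V)).Reachable ⟨x, hx⟩ ⟨z, hz⟩) (Finset.filter_subset _ _)
      ⟨x, Finset.mem_filter.2 ⟨hx, hx, SimpleGraph.Reachable.refl _⟩⟩
      (by
        intro u hu v hv huv
        obtain ⟨-, hu', hr⟩ := Finset.mem_filter.1 hu
        refine Finset.mem_filter.2 ⟨hv, hv, hr.trans ?_⟩
        exact SimpleGraph.Adj.reachable (by simpa using huv))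
    obtain ⟨-, _, hr⟩ := Finset.mem_filter.1 (hsub hy)
    exact hr

theorem gConnBundle_empty : GConnBundle G (∅ : Finset V) := by
  rintro ⟨x, hx⟩
  simp at hx

theorem gConnBundle_singleton (x : V) : GConnBundle G {x} := by
  rw [gConnBundle_iff]
  rintro T hT ⟨y, hy⟩ -
  grind

theorem SimpleGraph.Connected.gConnBundle_univ [Fintype V] (hG : G.Connected) :
    GConnBundle G (Finset.univ : Finset V) := by
  rintro ⟨x, hx⟩ ⟨y, hy⟩
  have hr := hG.preconnected x y
  rw [SimpleGraph.reachable_iff_reflTransGen] at hr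
  have key : ∀ z, Relation.ReflTransGen G.Adj x z →
      (G.induce (↑(Finset.univ : Finset V) : Set V)).Reachable ⟨x, hx⟩ ⟨z, by simp⟩ := by
    intro z hz
    induction hz with
    | refl => exact SimpleGraph.Reachable.refl _
    | tail _ hadj ih => exact ih.trans (SimpleGraph.Adj.reachable (by simpa using hadj))
  exact key y hr

/-- A nonempty set `C` avoiding `c` all of whose outside neighbours equal `c`. -/
structure IsBranch (G : SimpleGraph V) (c : V) (C : Finset V) : Prop where
  nonempty : C.Nonempty
  notMem : c ∉ C
  mem_or_eq : ∀ x ∈ C, ∀ y, G.Adj x y → y ∈ C ∨ y = c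

/-- A branch whose complement contains more than its base. -/
def IsProperBranch (G : SimpleGraph V) (c : V) (C : Finset V) : Prop :=
  IsBranch G c C ∧ ∃ v, v ∉ C ∧ v ≠ c

theorem IsProperBranch.exists_minimal [Finite V] {c : V} {C : Finset V}
    (hC : IsProperBranch G c C) :
    ∃ b, ∃ B ⊆ C, IsProperBranch G b B ∧ ∀ d D, IsProperBranch G d D → D ⊆ B → B ⊆ D := by
  classical
  obtain ⟨⟨b, B⟩, ⟨hBC, hB⟩, hmin⟩ := Set.exists_min_image
    {p : V × Finset V | p.2 ⊆ C ∧ IsProperBranch G p.1 p.2} (fun p => p.2.card) (Set.toFinite _)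
    ⟨(c, C), subset_rfl, hC⟩
  refine ⟨b, B, hBC, hB, fun d D hD hDB => ?_⟩
  exact (Finset.eq_of_subset_of_card_le hDB (hmin (d, D) ⟨hDB.trans hBC, hD⟩)).ge

theorem IsBranch.exists_adj [Fintype V] {c : V} {C : Finset V} (h : IsBranch G c C)
    (hG : G.Connected) : ∃ x ∈ C, G.Adj x c := by
  by_contra! hno
  have h1 := h.mem_or_eq
  have h2 := gConnBundle_iff.1 hG.gConnBundle_univ C (Finset.subset_univ _) h.nonempty
    (fun x hx y _ hxy => by grind)
  exact h.notMem (h2 (Finset.mem_univ c))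

variable [DecidableEq V]

theorem GConnBundle.insert_of_adj {T : Finset V} (hT : GConnBundle G T) {y z : V}
    (hz : z ∈ T) (hzy : G.Adj z y) : GConnBundle G (insert y T) := by
  rw [gConnBundle_iff] at hT ⊢
  intro U hU hne hcl
  have hyz := hzy.symm
  have h1 : (U ∩ T).Nonempty := by
    obtain ⟨u, hu⟩ := hne
    by_cases h : u ∈ T
    · exact ⟨u, by grind⟩
    · exact ⟨z, by grind⟩
  have h2 := hT (U ∩ T) Finset.inter_subset_right h1 (by grind)
  grind

theorem IsBranch.subset_of_gConnBundle {c y : V} {C Y : Finset V} (h : IsBranch G c C)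
    (hY : GConnBundle G Y) (hc : c ∉ Y) (hyY : y ∈ Y) (hyC : y ∈ C) : Y ⊆ C := by
  rw [gConnBundle_iff] at hY
  have h1 := h.mem_or_eq
  have := hY (Y ∩ C) Finset.inter_subset_left ⟨y, by grind⟩ (by grind)
  grind

theorem IsBranch.inter {b c : V} {B C : Finset V} (hB : IsBranch G b B) (hC : IsBranch G c C)
    (hne : (C ∩ B).Nonempty) (hb : b ∉ C) : IsBranch G c (C ∩ B) := by
  have h1 := hB.mem_or_eq
  have h2 := hC.mem_or_eq
  have h3 := hC.notMem
  exact ⟨hne, by grind, by grind⟩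

theorem IsBranch.card_inter_le_two {a b c p q r : V} {B C W Y : Finset V} (hB : IsBranch G b B)
    (hC : IsBranch G c C) (hY : GConnBundle G Y) (hb : b ∉ Y) (hc : c ∉ Y) (hq : q ∈ B)
    (hr : r ∈ C) (hBout : a ∉ B ∧ c ∉ B ∧ p ∉ B ∧ r ∉ B) (hCout : a ∉ C ∧ b ∉ C ∧ p ∉ C ∧ q ∉ C)
    (hW : ∀ v ∈ W, v = a ∨ v = b ∨ v = c ∨ v = p ∨ v = q ∨ v = r) : (W ∩ Y).card ≤ 2 := by
  have h1 : q ∈ Y → Y ⊆ B := fun h => hB.subset_of_gConnBundle hY hb h hq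
  have h2 : r ∈ Y → Y ⊆ C := fun h => hC.subset_of_gConnBundle hY hc h hr
  by_cases hqY : q ∈ Y
  · exact (Finset.card_le_card (show W ∩ Y ⊆ {q, q} by grind)).trans Finset.card_le_two
  by_cases hrY : r ∈ Y
  · exact (Finset.card_le_card (show W ∩ Y ⊆ {r, r} by grind)).trans Finset.card_le_two
  · exact (Finset.card_le_card (show W ∩ Y ⊆ {a, p} by grind)).trans Finset.card_le_two

/-- Two agents who both value exactly the items of `W` at `1` get a nearly even split of `W`. -/
theorem exists_balanced_split
    (h : ∀ w : V → ℝ, (∀ v, w v = 0 ∨ w v = 1) → ∃ A : Fin 2 → Finset V, GConnAlloc G A ∧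
      GEF1 G (fun _ I => ∑ v ∈ I, w v) A) (W : Finset V) :
    ∃ X Y, GConnBundle G X ∧ GConnBundle G Y ∧ (∀ v, v ∈ Y ↔ v ∉ X) ∧
      W.card ≤ 2 * (W ∩ X).card + 1 ∧ W.card ≤ 2 * (W ∩ Y).card + 1 := by
  obtain ⟨A, ⟨hconn, hdisj, hcov⟩, hEF⟩ := h (fun v => if v ∈ W then 1 else 0)
    (fun v => by by_cases hv : v ∈ W <;> simp [hv])
  have hsum : ∀ I : Finset V, ∑ v ∈ I, (if v ∈ W then 1 else 0 : ℝ) = ((W ∩ I).card : ℝ) := by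
    intro I
    rw [Finset.sum_boole, Finset.filter_mem_eq_inter, Finset.inter_comm]
  have hle : ∀ i j, (W ∩ A j).card ≤ (W ∩ A i).card + 1 := by
    intro i j
    rcases hEF i j with h0 | ⟨v, -, -, hv⟩
    · simp [h0]
    · simp only [hsum, Nat.cast_le] at hv
      have hsub : W ∩ A j ⊆ insert v (W ∩ (A j \ {v})) := by grind
      have := (Finset.card_le_card hsub).trans (Finset.card_insert_le _ _)
      omega
  have hcompl : ∀ v, v ∈ A 1 ↔ v ∉ A 0 := by
    intro v
    have h1 : v ∈ A 0 → v ∉ A 1 := fun hv =>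
      Finset.disjoint_left.1 (hdisj 0 1 (by decide)) hv
    have h2 := hcov v
    rw [Fin.exists_fin_two] at h2
    tauto
  have hadd : (W ∩ A 0).card + (W ∩ A 1).card = W.card := by
    rw [← Finset.card_union_of_disjoint (by rw [Finset.disjoint_left]; grind)]
    congr 1
    grind
  have h01 := hle 0 1
  have h10 := hle 1 0
  exact ⟨A 0, A 1, hconn 0, hconn 1, hcompl, by omega, by omega⟩

theorem eq_base_of_disjoint_branches
    (h : ∀ W : Finset V, ∃ X Y, GConnBundle G X ∧ GConnBundle G Y ∧ (∀ v, v ∈ Y ↔ v ∉ X) ∧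
      W.card ≤ 2 * (W ∩ X).card + 1 ∧ W.card ≤ 2 * (W ∩ Y).card + 1)
    {c v : V} {C D : Finset V} (hC : IsBranch G c C) (hD : IsBranch G c D) (hCD : Disjoint C D)
    (hvC : v ∉ C) (hvD : v ∉ D) : v = c := by
  by_contra hvc
  obtain ⟨p, hp⟩ := hC.nonempty
  obtain ⟨q, hq⟩ := hD.nonempty
  have hpD := Finset.disjoint_left.1 hCD hp
  have hqC := Finset.disjoint_right.1 hCD hq
  have hc := hC.notMem
  have hc' := hD.notMem
  have hcard : ({c, p, q, v} : Finset V).card = 4 := by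
    repeat rw [Finset.card_insert_of_notMem (by grind)]
    simp
  have key : ∀ Y, GConnBundle G Y → c ∉ Y → (({c, p, q, v} : Finset V) ∩ Y).card ≤ 1 := by
    intro Y hY hcY
    have h1 : p ∈ Y → Y ⊆ C := fun h => hC.subset_of_gConnBundle hY hcY h hp
    have h2 : q ∈ Y → Y ⊆ D := fun h => hD.subset_of_gConnBundle hY hcY h hq
    rw [Finset.card_le_one]
    grind
  obtain ⟨X, Y, hX, hY, hXY, h1, h2⟩ := h {c, p, q, v}
  by_cases hcX : c ∈ X
  · have := key Y hY (by grind)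
    omega
  · have := key X hX hcX
    omega

theorem not_three_distinct_branches
    (h : ∀ W : Finset V, ∃ X Y, GConnBundle G X ∧ GConnBundle G Y ∧ (∀ v, v ∈ Y ↔ v ∉ X) ∧
      W.card ≤ 2 * (W ∩ X).card + 1 ∧ W.card ≤ 2 * (W ∩ Y).card + 1)
    {a b c : V} {A B C : Finset V} (hA : IsBranch G a A) (hB : IsBranch G b B)
    (hC : IsBranch G c C) (hab : a ≠ b) (hac : a ≠ c) (hbc : b ≠ c) (hAB : Disjoint A B)
    (hAC : Disjoint A C) (hBC : Disjoint B C) (haB : a ∉ B) (haC : a ∉ C) (hbA : b ∉ A)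
    (hbC : b ∉ C) (hcA : c ∉ A) (hcB : c ∉ B) : False := by
  obtain ⟨p, hp⟩ := hA.nonempty
  obtain ⟨q, hq⟩ := hB.nonempty
  obtain ⟨r, hr⟩ := hC.nonempty
  have haA := hA.notMem
  have hbB := hB.notMem
  have hcC := hC.notMem
  have hpB := Finset.disjoint_left.1 hAB hp
  have hpC := Finset.disjoint_left.1 hAC hp
  have hqA := Finset.disjoint_right.1 hAB hq
  have hqC := Finset.disjoint_left.1 hBC hq
  have hrA := Finset.disjoint_right.1 hAC hr
  have hrB := Finset.disjoint_right.1 hBC hr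
  obtain ⟨W, hW⟩ : ∃ W : Finset V, W = {a, b, c, p, q, r} := ⟨_, rfl⟩
  have hcard : W.card = 6 := by
    subst hW
    repeat rw [Finset.card_insert_of_notMem (by grind)]
    simp
  have key : ∀ Y, GConnBundle G Y → (b ∉ Y ∧ c ∉ Y ∨ a ∉ Y ∧ c ∉ Y ∨ a ∉ Y ∧ b ∉ Y) →
      (W ∩ Y).card ≤ 2 := by
    rintro Y hY (⟨h1, h2⟩ | ⟨h1, h2⟩ | ⟨h1, h2⟩)
    · exact hB.card_inter_le_two (a := a) (p := p) hC hY h1 h2 hq hr (by simp [*]) (by simp [*])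
        (by grind)
    · exact hA.card_inter_le_two (a := b) (p := q) hC hY h1 h2 hp hr (by simp [*]) (by simp [*])
        (by grind)
    · exact hA.card_inter_le_two (a := c) (p := r) hB hY h1 h2 hp hq (by simp [*]) (by simp [*])
        (by grind)
  obtain ⟨X, Y, hX, hY, hXY, h1, h2⟩ := h W
  have hX' := key X hX
  have hY' := key Y hY
  rw [hXY, hXY, hXY] at hY'
  by_cases hside : b ∉ X ∧ c ∉ X ∨ a ∉ X ∧ c ∉ X ∨ a ∉ X ∧ b ∉ X
  · have := hX' hside
    omega
  · have := hY' (by clear * - hside; tauto)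
    omega

variable [Fintype V]

theorem IsProperBranch.compl {c : V} {C : Finset V} (h : IsProperBranch G c C) :
    IsProperBranch G c (Finset.univ \ insert c C) := by
  obtain ⟨h, v, hv⟩ := h
  obtain ⟨x, hx⟩ := h.nonempty
  have h1 := h.mem_or_eq
  have h2 := h.notMem
  refine ⟨⟨⟨v, by grind⟩, by grind, ?_⟩, x, by grind, by grind⟩
  intro x hx y hxy
  have := hxy.symm
  grind

theorem IsBranch.inter_nonempty {b c : V} {B C : Finset V} (hG : G.Connected)
    (hB : IsBranch G b B) (hC : IsBranch G c C) (hc : c ∈ B) (hb : b ∉ C) :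
    (C ∩ B).Nonempty := by
  obtain ⟨x, hx, hxc⟩ := hC.exists_adj hG
  have := hB.mem_or_eq c hc x hxc.symm
  exact ⟨x, by grind⟩

theorem IsProperBranch.notMem_of_minimal {b c : V} {B C : Finset V} (hG : G.Connected)
    (hB : IsProperBranch G b B) (hmin : ∀ d D, IsProperBranch G d D → D ⊆ B → B ⊆ D)
    (hC : IsProperBranch G c C) : c ∉ B := by
  have key : ∀ D, IsProperBranch G c D → b ∉ D → c ∉ B := by
    intro D hD hb hc
    have hI := hB.1.inter hD.1 (hB.1.inter_nonempty hG hD.1 hc hb) hb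
    have hsub := hmin c _ ⟨hI, b, by grind, by have := hB.1.notMem; grind⟩
      Finset.inter_subset_right
    exact hD.1.notMem (Finset.mem_inter.1 (hsub hc)).1
  by_cases hb : b ∈ C
  · exact key _ hC.compl (by grind)
  · exact key C hC hb

theorem IsProperBranch.subset_of_minimal {b c x : V} {B C : Finset V} (hG : G.Connected)
    (hB : IsProperBranch G b B) (hmin : ∀ d D, IsProperBranch G d D → D ⊆ B → B ⊆ D)
    (hC : IsProperBranch G c C) (hxB : x ∈ B) (hxC : x ∈ C) : B ⊆ C := by
  have hc := hB.notMem_of_minimal hG hmin hC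
  obtain ⟨hB1, v, hv1, hv2⟩ := hB
  have h1 := hB1.mem_or_eq
  have h2 := hC.1.mem_or_eq
  have hI : IsBranch G b (B ∩ C) := ⟨⟨x, by grind⟩, by have := hB1.notMem; grind, by grind⟩
  exact (hmin b _ ⟨hI, v, by grind, hv2⟩ Finset.inter_subset_left).trans Finset.inter_subset_right

/-- If no vertex carries three disjoint branches and no three disjoint branches have distinct
bases outside one another, then two vertices meet every branch. -/
theorem exists_two_ends (hG : G.Connected) (hV : Nontrivial V)
    (hsame : ∀ c C D, IsBranch G c C → IsBranch G c D → Disjoint C D →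
      ∀ v, v ∉ C → v ∉ D → v = c)
    (hdist : ∀ a b c A B C, IsBranch G a A → IsBranch G b B → IsBranch G c C →
      a ≠ b → a ≠ c → b ≠ c → Disjoint A B → Disjoint A C → Disjoint B C →
      a ∉ B → a ∉ C → b ∉ A → b ∉ C → c ∉ A → c ∉ B → False) :
    ∃ s t, s ≠ t ∧ ∀ c C, IsBranch G c C → s ∈ C ∨ t ∈ C := by
  by_cases hex : ∃ c C, IsProperBranch G c C
  swap
  · obtain ⟨s, t, hst⟩ := hV.exists_pair_ne
    refine ⟨s, t, hst, fun c C hC => ?_⟩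
    by_contra! hcon
    by_cases hs : s = c
    · exact hex ⟨c, C, hC, t, hcon.2, hs ▸ hst.symm⟩
    · exact hex ⟨c, C, hC, s, hcon.1, hs⟩
  obtain ⟨c₀, C₀, h₀⟩ := hex
  obtain ⟨a, A, -, hA, hAmin⟩ := h₀.exists_minimal
  obtain ⟨b, B, hBA, hB, hBmin⟩ := hA.compl.exists_minimal
  have hAB : Disjoint A B := Finset.disjoint_right.2 fun x hx => by
    have := hBA hx
    grind
  obtain ⟨s, hs⟩ := hA.1.nonempty
  obtain ⟨t, ht⟩ := hB.1.nonempty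
  have hst : s ≠ t := fun h => Finset.disjoint_left.1 hAB hs (h ▸ ht)
  refine ⟨s, t, hst, fun c C hC => ?_⟩
  by_contra! hcon
  have hCp : IsProperBranch G c C := by
    refine ⟨hC, ?_⟩
    by_cases hs : s = c
    · exact ⟨t, hcon.2, hs ▸ hst.symm⟩
    · exact ⟨s, hcon.1, hs⟩
  have hCA : Disjoint A C := Finset.disjoint_left.2 fun x hx hxC =>
    hcon.1 (hA.subset_of_minimal hG hAmin hCp hx hxC hs)
  have hCB : Disjoint B C := Finset.disjoint_left.2 fun x hx hxC =>
    hcon.2 (hB.subset_of_minimal hG hBmin hCp hx hxC ht)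
  have hcA := hA.notMem_of_minimal hG hAmin hCp
  have hcB := hB.notMem_of_minimal hG hBmin hCp
  have hbA := hA.notMem_of_minimal hG hAmin hB
  have haB := hB.notMem_of_minimal hG hBmin hA
  have haC : a ∉ C := fun h => by
    obtain ⟨x, hx, hxa⟩ := hA.1.exists_adj hG
    rcases hC.mem_or_eq a h x hxa.symm with h' | rfl
    · exact Finset.disjoint_left.1 hCA hx h'
    · exact hcA hx
  have hbC : b ∉ C := fun h => by
    obtain ⟨x, hx, hxb⟩ := hB.1.exists_adj hG
    rcases hC.mem_or_eq b h x hxb.symm with h' | rfl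
    · exact Finset.disjoint_left.1 hCB hx h'
    · exact hcB hx
  obtain ⟨z, hz⟩ := hC.nonempty
  have hzA := Finset.disjoint_right.1 hCA hz
  have hzB := Finset.disjoint_right.1 hCB hz
  by_cases hab : a = b
  · subst hab
    have := hsame a A B hA.1 hB.1 hAB z hzA hzB
    exact haC (this ▸ hz)
  by_cases hac : a = c
  · subst hac
    have := hsame a A C hA.1 hC hCA t (Finset.disjoint_right.1 hAB ht) hcon.2
    exact haB (this ▸ ht)
  by_cases hbc : b = c
  · subst hbc
    have := hsame b B C hB.1 hC hCB s (Finset.disjoint_left.1 hAB hs) hcon.1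
    exact hbA (this ▸ hs)
  exact hdist a b c A B C hA.1 hB.1 hC hab hac hbc hAB hCA hCB haB haC hbA hbC hcA hcB

/-- If every branch contains `s` or `t`, a connected set containing `s` whose complement is connected
and contains `t` can be enlarged by one vertex, unless only `t` is left. -/
theorem exists_extend_prefix (s t : V) (hst : ∀ c C, IsBranch G c C → s ∈ C ∨ t ∈ C)
    {X : Finset V} (hs : s ∈ X) (ht : t ∉ X) (hX : GConnBundle G X)
    (hY : GConnBundle G Xᶜ) (hne : ∃ y, y ∉ X ∧ y ≠ t) :
    ∃ x, x ∉ X ∧ x ≠ t ∧ GConnBundle G (insert x X) ∧ GConnBundle G (insert x X)ᶜ := by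
  classical
  have hcand : ∃ x, x ∉ X ∧ x ≠ t ∧ ∃ z ∈ X, G.Adj z x := by
    by_contra! hno
    obtain ⟨y, hy⟩ := hne
    have := hst t (Finset.univ \ insert t X) ⟨⟨y, by simp [hy]⟩, by simp, fun x hx y hxy => by
      have := hxy.symm
      have := hno x
      grind⟩
    grind
  obtain ⟨x₀, hx₀, hxt₀, hz₀⟩ := hcand
  obtain ⟨⟨x, T⟩, hxT, hmax⟩ := Set.exists_max_image
    {p : V × Finset V | p.1 ∉ X ∧ (∃ z ∈ X, G.Adj z p.1) ∧ (∀ v ∈ p.2, v ∉ X) ∧ p.1 ∉ p.2 ∧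
      t ∈ p.2 ∧ GConnBundle G p.2} (fun p => p.2.card) (Set.toFinite _)
    ⟨(x₀, {t}), hx₀, hz₀, by grind, by grind, by simp, gConnBundle_singleton t⟩
  simp only [Set.mem_ofPred_eq, Prod.forall] at hxT hmax
  obtain ⟨hxX, ⟨z, hz, hzx⟩, hTX, hxT, htT, hT⟩ := hxT
  have hTnbr : ∀ u ∈ T, ∀ y, y ∉ X → G.Adj u y → y ∈ T ∨ y = x := by
    intro u hu y hy huy
    by_contra! hcon
    have := hmax x (insert y T) ⟨hxX, ⟨z, hz, hzx⟩, by grind, by grind, by grind,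
      hT.insert_of_adj hu huy⟩
    rw [Finset.card_insert_of_notMem hcon.1] at this
    omega
  have hTx : ∃ u ∈ T, G.Adj u x := by
    by_contra! hno
    have := gConnBundle_iff.1 hY T (by intro v hv; simpa using hTX v hv) ⟨t, htT⟩ (by
      intro u hu y hy huy
      rcases hTnbr u hu y (by simpa using hy) huy with h | rfl
      · exact h
      · exact absurd huy (hno u hu))
    exact hxT (this (by simpa using hxX))
  obtain ⟨u, hu, hux⟩ := hTx
  have hall : ∀ v, v ∉ X → v ≠ x → v ∈ T := by
    by_contra! hcon
    obtain ⟨d, hdX, hdx, hdT⟩ := hcon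
    have hD : ∀ v, v ∉ X → v ≠ x → v ∉ T → ∀ y ∈ X, ¬ G.Adj y v := by
      intro v hv hvx hvT y hy hyv
      have := hmax v (insert x T) ⟨hv, ⟨y, hy, hyv⟩, by grind, by grind, by grind,
        hT.insert_of_adj hu hux⟩
      rw [Finset.card_insert_of_notMem hxT] at this
      omega
    have := hst x (Finset.univ \ (insert x (X ∪ T))) ⟨⟨d, by grind⟩, by grind, by
      intro v hv y hvy
      have := hvy.symm
      have := hD v
      have := hTnbr y
      grind⟩
    grind
  refine ⟨x, hxX, by grind, hX.insert_of_adj hz hzx, ?_⟩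
  have : (insert x X)ᶜ = T := by
    ext v
    simp only [Finset.mem_compl, Finset.mem_insert]
    grind
  rwa [this]

theorem exists_bipolar_list (hG : G.Connected) (s t : V)
    (hst : ∀ c C, IsBranch G c C → s ∈ C ∨ t ∈ C) (n : ℕ) :
    ∀ X : Finset V, Xᶜ.card = n → s ∈ X → t ∉ X → GConnBundle G X → GConnBundle G Xᶜ →
    ∃ l : List V, l.Nodup ∧ (∀ v, v ∈ l ↔ v ∉ X) ∧ ∀ k,
      GConnBundle G (X ∪ (l.take k).toFinset) ∧ GConnBundle G (l.drop k).toFinset := by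
  induction n with
  | zero =>
    intro X hX hs ht
    rw [Finset.card_eq_zero] at hX
    exact absurd (by simpa using ht : t ∈ Xᶜ) (by simp [hX])
  | succ n ih =>
    intro X hcard hs ht hX hY
    by_cases hne : ∃ y, y ∉ X ∧ y ≠ t
    · obtain ⟨x, hx, hxt, h1, h2⟩ := exists_extend_prefix s t hst hs ht hX hY hne
      obtain ⟨l, hl, hmem, hk⟩ := ih (insert x X)
        (by
          rw [Finset.card_compl] at hcard ⊢
          rw [Finset.card_insert_of_notMem hx]
          omega) (by grind) (by grind) h1 h2
      refine ⟨x :: l, by grind, by grind, fun k => ?_⟩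
      cases k with
      | zero =>
        have : (x :: l).toFinset = Xᶜ := by
          ext v
          simp only [List.mem_toFinset, Finset.mem_compl]
          grind
        simpa [hX, this] using hY
      | succ k =>
        have := hk k
        simpa [Finset.union_insert, Finset.insert_union] using this
    · push Not at hne
      have hX' : Xᶜ = {t} := by
        ext v
        simp only [Finset.mem_compl, Finset.mem_singleton]
        grind
      refine ⟨[t], by simp, by grind, fun k => ?_⟩
      cases k with
      | zero => simpa [hX] using gConnBundle_singleton t
      | succ k =>
        have : X ∪ {t} = Finset.univ := by rw [← hX']; simp
        simpa [this, hG.gConnBundle_univ] using gConnBundle_empty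

theorem exists_bipolarNumbering_of_list (l : List V) (hl : l.Nodup) (hmem : ∀ v, v ∈ l)
    (hk : ∀ k, GConnBundle G (l.take k).toFinset ∧ GConnBundle G (l.drop k).toFinset) :
    ∃ e : Fin (Fintype.card V) ≃ V, BipolarNumbering G e := by
  have hlen : Fintype.card V = l.length := by
    rw [← List.toFinset_card_of_nodup hl, ← Finset.card_univ]
    congr 1
    ext v
    simp [hmem]
  let e := (finCongr hlen).trans (hl.getEquivOfForallMemList l hmem)
  have he : ∀ i, e i = l[(i : ℕ)]'(hlen ▸ i.2) := fun i => rfl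
  refine ⟨e, fun j => ⟨?_, ?_⟩⟩
  · convert (hk (j + 1)).1
    ext v
    simp only [Finset.mem_image, Finset.mem_Iic, List.mem_toFinset, List.mem_take_iff_getElem, he]
    constructor
    · rintro ⟨i, hi, rfl⟩
      exact ⟨i, by have := i.2; rw [Fin.le_def] at hi; omega, rfl⟩
    · rintro ⟨i, hi, rfl⟩
      exact ⟨⟨i, by omega⟩, by rw [Fin.le_def]; simp only; omega, rfl⟩
  · convert (hk j).2
    ext v
    simp only [Finset.mem_image, Finset.mem_Ici, List.mem_toFinset, List.mem_drop_iff_getElem, he]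
    constructor
    · rintro ⟨i, hi, rfl⟩
      rw [Fin.le_def] at hi
      refine ⟨i - j, by have := i.2; omega, ?_⟩
      congr 1
      omega
    · rintro ⟨i, hi, rfl⟩
      exact ⟨⟨j + i, by omega⟩, by rw [Fin.le_def]; simp, by simp [Nat.add_comm]⟩

theorem exists_bipolarNumbering_of_ends (hG : G.Connected) {s t : V} (hne : s ≠ t)
    (hst : ∀ c C, IsBranch G c C → s ∈ C ∨ t ∈ C) :
    ∃ e : Fin (Fintype.card V) ≃ V, BipolarNumbering G e := by
  have hsc : GConnBundle G ({s}ᶜ : Finset V) := by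
    rw [gConnBundle_iff]
    intro T hT hTne hcl v hv
    have hsT : s ∉ T := fun h => by simpa using hT h
    have hB : ∀ D : Finset V, D.Nonempty → s ∉ D →
        (∀ x ∈ D, ∀ y, y ≠ s → G.Adj x y → y ∈ D) → t ∈ D := fun D hD hsD h =>
      (hst s D ⟨hD, hsD, fun x hx y hxy => by grind⟩).resolve_left hsD
    have htT : t ∈ T := hB T hTne hsT fun x hx y hy hxy => hcl x hx y (by simpa using hy) hxy
    by_contra hvT
    have := hB (Finset.univ \ insert s T) ⟨v, by simp at hv; grind⟩ (by grind)
      (fun x hx y hy hxy => by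
        have := hcl y
        have := hxy.symm
        have : x ∈ ({s}ᶜ : Finset V) := by simp; grind
        grind)
    grind
  obtain ⟨l, hl, hmem, hk⟩ := exists_bipolar_list hG s t hst _ {s} rfl (by simp)
    (by simpa using hne.symm) (gConnBundle_singleton s) hsc
  refine exists_bipolarNumbering_of_list (s :: l) (by grind) (by grind) fun k => ?_
  cases k with
  | zero =>
    have : (s :: l).toFinset = Finset.univ := by
      ext v
      simp only [List.mem_toFinset, Finset.mem_univ, iff_true]
      grind
    rw [List.drop_zero, this]
    exact ⟨by simpa using gConnBundle_empty, hG.gConnBundle_univ⟩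
  | succ k => simpa [Finset.singleton_union] using hk k

theorem BipolarNumbering.gConnBundle_lt {e : Fin (Fintype.card V) ≃ V} (he : BipolarNumbering G e)
    (k : ℕ) : GConnBundle G (Finset.univ.filter fun v => (e.symm v : ℕ) < k) := by
  rcases Nat.eq_zero_or_pos k with rfl | hk
  · simpa using gConnBundle_empty
  rcases Nat.eq_zero_or_pos (Fintype.card V) with h0 | h0
  · rintro ⟨x, -⟩
    exact absurd (e.symm x).2 (by omega)
  convert (he ⟨min k (Fintype.card V) - 1, by omega⟩).1
  ext v
  have := (e.symm v).2
  simp only [Finset.mem_filter, Finset.mem_univ, true_and, Finset.mem_image, Finset.mem_Iic]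
  constructor
  · exact fun h => ⟨e.symm v, by rw [Fin.le_def]; simp only; omega, by simp⟩
  · rintro ⟨i, hi, rfl⟩
    rw [Fin.le_def] at hi
    simp only [Equiv.symm_apply_apply] at *
    omega

theorem BipolarNumbering.gConnBundle_ge {e : Fin (Fintype.card V) ≃ V} (he : BipolarNumbering G e)
    (k : ℕ) : GConnBundle G (Finset.univ.filter fun v => k ≤ (e.symm v : ℕ)) := by
  by_cases hk : k < Fintype.card V
  · convert (he ⟨k, hk⟩).2
    ext v
    simp only [Finset.mem_filter, Finset.mem_univ, true_and, Finset.mem_image, Finset.mem_Ici]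
    constructor
    · exact fun h => ⟨e.symm v, h, by simp⟩
    · rintro ⟨i, hi, rfl⟩
      rw [Fin.le_def] at hi
      simpa using hi
  · convert gConnBundle_empty
    ext v
    have := (e.symm v).2
    simp
    omega

/-- Cutting a bipolar numbering at the first item that tips the balance for agent `0` and letting
agent `1` choose yields an EF1 allocation. -/
theorem BipolarNumbering.exists_gEF1 [Nonempty V] {e : Fin (Fintype.card V) ≃ V}
    (he : BipolarNumbering G e) (u : Fin 2 → Finset V → ℝ) (hu : ∀ i, GMonotonic (u i)) :
    ∃ A : Fin 2 → Finset V, GConnAlloc G A ∧ GEF1 G u A := by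
  classical
  set L : ℕ → Finset V := fun k => Finset.univ.filter fun v => (e.symm v : ℕ) < k with hL
  set R : ℕ → Finset V := fun k => Finset.univ.filter fun v => k ≤ (e.symm v : ℕ) with hR
  have hLconn : ∀ k, GConnBundle G (L k) := he.gConnBundle_lt
  have hRconn : ∀ k, GConnBundle G (R k) := he.gConnBundle_ge
  have hLR : ∀ k v, v ∈ R k ↔ v ∉ L k := fun k v => by simp [hL, hR]
  have hLmono : ∀ k, L k ⊆ L (k + 1) := fun k v => by simp [hL]; omega
  have hRmono : ∀ k, R (k + 1) ⊆ R k := fun k v => by simp [hR]; omega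
  have hLsucc : ∀ k (hk : k < Fintype.card V), L (k + 1) \ {e ⟨k, hk⟩} = L k := by
    intro k hk
    ext v
    simp [hL, ← Equiv.symm_apply_eq, Fin.ext_iff]
    omega
  have hRsucc : ∀ k (hk : k < Fintype.card V), R k \ {e ⟨k, hk⟩} = R (k + 1) := by
    intro k hk
    ext v
    simp [hR, ← Equiv.symm_apply_eq, Fin.ext_iff]
    omega
  have hL0 : L 0 = ∅ := by simp [hL]
  have hRm : ∀ k, Fintype.card V ≤ k → R k = ∅ := by
    intro k hk
    ext v
    have := (e.symm v).2
    simp [hR]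
    omega
  have hLout : ∀ i, ∀ k < Fintype.card V, ∀ y, u i (L k) ≤ y →
      L (k + 1) = ∅ ∨ ∃ v ∈ L (k + 1), GConnBundle G (L (k + 1) \ {v}) ∧
        u i (L (k + 1) \ {v}) ≤ y := by
    intro i k hk y hy
    refine Or.inr ⟨e ⟨k, hk⟩, by simp [hL], ?_⟩
    rw [hLsucc]
    exact ⟨hLconn k, hy⟩
  have hRout : ∀ i k y, u i (R (k + 1)) ≤ y →
      R k = ∅ ∨ ∃ v ∈ R k, GConnBundle G (R k \ {v}) ∧ u i (R k \ {v}) ≤ y := by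
    intro i k y hy
    by_cases hk : k < Fintype.card V
    · refine Or.inr ⟨e ⟨k, hk⟩, by simp [hR], ?_⟩
      rw [hRsucc]
      exact ⟨hRconn _, hy⟩
    · exact Or.inl (hRm k (by omega))
  have hLout' : ∀ i, ∀ k ≤ Fintype.card V, ∀ y, u i (L k) ≤ y →
      L k = ∅ ∨ ∃ v ∈ L k, GConnBundle G (L k \ {v}) ∧ u i (L k \ {v}) ≤ y := by
    intro i k hk y hy
    cases k with
    | zero => exact Or.inl hL0
    | succ k => exact hLout i k hk y ((hu i _ _ (hLmono k)).trans hy)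
  have hRout' : ∀ i k y, u i (R k) ≤ y →
      R k = ∅ ∨ ∃ v ∈ R k, GConnBundle G (R k \ {v}) ∧ u i (R k \ {v}) ≤ y :=
    fun i k y hy => hRout i k y ((hu i _ _ (hRmono k)).trans hy)
  have hcard : 0 < Fintype.card V := Fintype.card_pos
  have hex : ∃ k, u 0 (R (k + 1)) ≤ u 0 (L (k + 1)) :=
    ⟨Fintype.card V - 1, by rw [hRm _ (by omega)]; exact hu 0 _ _ (Finset.empty_subset _)⟩
  obtain ⟨k, hkm, hk, hk'⟩ : ∃ k < Fintype.card V, u 0 (R (k + 1)) ≤ u 0 (L (k + 1)) ∧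
      u 0 (L k) ≤ u 0 (R k) := by
    refine ⟨Nat.find hex, ?_, Nat.find_spec hex, ?_⟩
    · have := Nat.find_min' hex (m := Fintype.card V - 1)
        (by rw [hRm _ (by omega)]; exact hu 0 _ _ (Finset.empty_subset _))
      omega
    · cases hf : Nat.find hex with
      | zero => rw [hL0]; exact hu 0 _ _ (Finset.empty_subset _)
      | succ j => exact (not_le.1 (Nat.find_min hex (m := j) (by omega))).le
  rcases le_total (u 1 (R (k + 1))) (u 1 (L k)) with h | h
  · refine ⟨![R k, L k], ⟨?_, ?_, ?_⟩, ?_⟩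
    · simp [Fin.forall_fin_two, hLconn, hRconn]
    · simp [Fin.forall_fin_two, Finset.disjoint_left, hLR]
    · intro v
      simp [Fin.exists_fin_two, hLR]
      tauto
    · simp only [GEF1, Fin.forall_fin_two]
      exact ⟨⟨hRout' 0 k _ le_rfl, hLout' 0 k hkm.le _ hk'⟩, hRout 1 k _ h,
        hLout' 1 k hkm.le _ le_rfl⟩
  · refine ⟨![L (k + 1), R (k + 1)], ⟨?_, ?_, ?_⟩, ?_⟩
    · simp [Fin.forall_fin_two, hLconn, hRconn]
    · simp [Fin.forall_fin_two, Finset.disjoint_left, hLR]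
    · intro v
      simp [Fin.exists_fin_two, hLR]
      tauto
    · simp only [GEF1, Fin.forall_fin_two]
      exact ⟨⟨hLout' 0 _ hkm _ le_rfl, hRout' 0 _ _ hk⟩, hLout 1 k hkm _ h,
        hRout' 1 _ _ le_rfl⟩

theorem exists_bipolarNumbering (hG : G.Connected)
    (h : ∀ w : V → ℝ, (∀ v, w v = 0 ∨ w v = 1) → ∃ A : Fin 2 → Finset V, GConnAlloc G A ∧
      GEF1 G (fun _ I => ∑ v ∈ I, w v) A) :
    ∃ e : Fin (Fintype.card V) ≃ V, BipolarNumbering G e := by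
  rcases subsingleton_or_nontrivial V with hV | hV
  · exact ⟨(Fintype.equivFin V).symm, fun j =>
      ⟨fun x y => Subsingleton.elim x y ▸ SimpleGraph.Reachable.refl _,
        fun x y => Subsingleton.elim x y ▸ SimpleGraph.Reachable.refl _⟩⟩
  · have h' := exists_balanced_split h
    obtain ⟨s, t, hne, hst⟩ := exists_two_ends hG hV
      (fun c C D hC hD hCD v => eq_base_of_disjoint_branches h' hC hD hCD)
      (fun a b c A B C => not_three_distinct_branches h')
    exact exists_bipolarNumbering_of_ends hG hne hst

end GraphBranches

/-- for every connected finite graph `G`, the following are equivalent: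
(1) `G` admits a bipolar numbering;
(2) for every pair of monotonic valuations for two agents there exists a connected EF1
allocation;
(3) for every identical, additive, binary valuations for two agents there exists a
connected EF1 allocation. -/
theorem bipolar_EF1_characterization {V : Type*} [Fintype V] [DecidableEq V]
    (G : SimpleGraph V) (hconn : G.Connected) :
    ((∃ e : Fin (Fintype.card V) ≃ V, BipolarNumbering G e) ↔
      (∀ u : Fin 2 → Finset V → ℝ, (∀ i, GMonotonic (u i)) → (∀ i, u i ∅ = 0) →
        ∃ A : Fin 2 → Finset V, GConnAlloc G A ∧ GEF1 G u A)) ∧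
    ((∀ u : Fin 2 → Finset V → ℝ, (∀ i, GMonotonic (u i)) → (∀ i, u i ∅ = 0) →
        ∃ A : Fin 2 → Finset V, GConnAlloc G A ∧ GEF1 G u A) ↔
      (∀ w : V → ℝ, (∀ v, w v = 0 ∨ w v = 1) →
        ∃ A : Fin 2 → Finset V, GConnAlloc G A ∧
          GEF1 G (fun _ I => ∑ v ∈ I, w v) A)) := by
  have := hconn.nonempty
  have h12 : (∃ e : Fin (Fintype.card V) ≃ V, BipolarNumbering G e) →
      ∀ u : Fin 2 → Finset V → ℝ, (∀ i, GMonotonic (u i)) → (∀ i, u i ∅ = 0) →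
        ∃ A : Fin 2 → Finset V, GConnAlloc G A ∧ GEF1 G u A :=
    fun ⟨_, he⟩ u hu _ => he.exists_gEF1 u hu
  have h23 : (∀ u : Fin 2 → Finset V → ℝ, (∀ i, GMonotonic (u i)) → (∀ i, u i ∅ = 0) →
        ∃ A : Fin 2 → Finset V, GConnAlloc G A ∧ GEF1 G u A) →
      ∀ w : V → ℝ, (∀ v, w v = 0 ∨ w v = 1) →
        ∃ A : Fin 2 → Finset V, GConnAlloc G A ∧ GEF1 G (fun _ I => ∑ v ∈ I, w v) A := by
    intro h w hw
    refine h _ (fun _ X Y hXY => ?_) (fun _ => Finset.sum_empty)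
    refine Finset.sum_le_sum_of_subset_of_nonneg hXY fun v _ _ => ?_
    rcases hw v with h | h <;> simp [h]
  have h31 := exists_bipolarNumbering hconn
  exact ⟨⟨h12, fun h => h31 (h23 h)⟩, h23, fun h => h12 (h31 h)⟩
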